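/- (Length bound for geodesics without domain constraint.) Let μ be a probability measure on ℝ^d, x, y ∈ ℝ^d, and let γ : [0,1] → ℝ^d be a Lipschitz path with γ(0) = x, γ(1) = y that is a geodesic for the unconstrained FDTM, i.e. D_μ(γ) = inf{D_μ(η) : η Lipschitz path from x to y}. Then |γ| ≤ (64·5^β·β)/(m·log 2) · sup_{t ∈ [0,1]} d_μ(γ(t)). -/

import Mathlib

open MeasureTheory Metric Set ProbabilityTheory
open scoped ENNReal NNReal

noncomputable section

/-- Euclidean space `ℝ^d`. -/
abbrev Euc (d : ℕ) := EuclideanSpace ℝ (Fin d)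

/-- The pseudo-distance-to-measure `δ_{μ,u}(x) = inf {r > 0 : μ(B(x,r)) > u}`. -/
def pseudoDTM {d : ℕ} (μ : Measure (Euc d)) (u : ℝ) (x : Euc d) : ℝ :=
  sInf {r : ℝ | 0 < r ∧ u < (μ (ball x r)).toReal}

/-- The distance-to-measure `d_μ(x) = ((1/m) ∫₀^m δ_{μ,u}(x)^p du)^{1/p}`. -/
def dtm {d : ℕ} (m p : ℝ) (μ : Measure (Euc d)) (x : Euc d) : ℝ :=
  ((1 / m) * ∫ u in Ioc (0 : ℝ) m, pseudoDTM μ u x ^ p) ^ (1 / p)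

/-- A Lipschitz path. -/
def IsLipschitzPath {d : ℕ} (γ : ℝ → Euc d) : Prop := ∃ K, LipschitzWith K γ

/-- Euclidean length `|γ| = ∫₀¹ ‖γ'(t)‖ dt`. -/
def eucLength {d : ℕ} (γ : ℝ → Euc d) : ℝ := ∫ t in Icc (0 : ℝ) 1, ‖deriv γ t‖

/-- FDTM length `D_μ(γ) = ∫₀¹ d_μ(γ(t))^β ‖γ'(t)‖ dt`. -/
def fdtmLength {d : ℕ} (m p β : ℝ) (μ : Measure (Euc d)) (γ : ℝ → Euc d) : ℝ :=
  ∫ t in Icc (0 : ℝ) 1, dtm m p μ (γ t) ^ β * ‖deriv γ t‖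

/-- Admissible paths `Γ_F(x,y)`: Lipschitz paths from `x` to `y` which may leave the domain `F`
only along straight lines. -/
def AdmissiblePath {d : ℕ} (F : Set (Euc d)) (x y : Euc d) (γ : ℝ → Euc d) : Prop :=
  IsLipschitzPath γ ∧ γ 0 = x ∧ γ 1 = y ∧
    ∀ a b : ℝ, 0 ≤ a → b ≤ 1 →
      (∀ t ∈ Ioo a b, γ t ∉ F) →
      ∃ u : Euc d, ‖u‖ = 1 ∧
        ∀ᵐ t ∂(volume.restrict (Ioo a b)), deriv γ t = ‖deriv γ t‖ • u

/-- The Fermat distance-to-measure `D_{μ,F}(x,y) = inf_{γ ∈ Γ_F(x,y)} D_μ(γ)`. -/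
def fdtm {d : ℕ} (m p β : ℝ) (μ : Measure (Euc d)) (F : Set (Euc d)) (x y : Euc d) : ℝ :=
  sInf {L : ℝ | ∃ γ : ℝ → Euc d, AdmissiblePath F x y γ ∧ L = fdtmLength m p β μ γ}

/-- A geodesic: an admissible path realizing the FDTM. -/
def IsGeodesic {d : ℕ} (m p β : ℝ) (μ : Measure (Euc d)) (F : Set (Euc d)) (x y : Euc d)
    (γ : ℝ → Euc d) : Prop :=
  AdmissiblePath F x y γ ∧ fdtmLength m p β μ γ = fdtm m p β μ F x y

/-- FDTM length of the straight segment `[x,y]`. -/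
def segFDTM {d : ℕ} (m p β : ℝ) (μ : Measure (Euc d)) (x y : Euc d) : ℝ :=
  ‖x - y‖ * ∫ t in Icc (0 : ℝ) 1, dtm m p μ ((1 - t) • x + t • y) ^ β

/-- The explicit constant `λ = 2·c·ρ^{β+1}/(ρ−1)` with `c = (16·5^β + 1152·165^β)/m^{2+β}`
and `ρ = 1 + 32/m`. -/
def fdtmConst (m β : ℝ) : ℝ :=
  2 * ((16 * (5 : ℝ) ^ β + 1152 * (165 : ℝ) ^ β) / m ^ (2 + β)) * (1 + 32 / m) ^ (β + 1) /
    ((1 + 32 / m) - 1)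

/-- Support of a measure: points all of whose neighborhoods have positive mass. -/
def measSupport {d : ℕ} (μ : Measure (Euc d)) : Set (Euc d) :=
  {x | ∀ r : ℝ, 0 < r → 0 < μ (ball x r)}

/-- `(a,b)`-standard measure: `μ(B(x,r)) ≥ a·r^b` for `x ∈ supp(μ)` and `0 < r ≤ a^{-1/b}`. -/
def IsStandard {d : ℕ} (μ : Measure (Euc d)) (a b : ℝ) : Prop :=
  ∀ x ∈ measSupport μ, ∀ r : ℝ, 0 < r → r ≤ a ^ (-(1 / b)) → a * r ^ b ≤ (μ (ball x r)).toReal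

/-- Greedy packing: points whose `ρ`-balls have mass at least `c` are covered by at most `1 / c`
balls of radius `2 * ρ` centred at such points. -/
lemma exists_finset_cover_of_measure_closedBall {X : Type*} [MetricSpace X] [MeasurableSpace X]
    [OpensMeasurableSpace X] (μ : Measure X) [IsProbabilityMeasure μ] {A : Set X} {ρ c : ℝ}
    (hρ : 0 ≤ ρ) (hc : 0 < c) (hA : ∀ x ∈ A, c ≤ μ.real (closedBall x ρ)) :
    ∃ T : Finset X, ↑T ⊆ A ∧ (T.card : ℝ) * c ≤ 1 ∧ ∀ x ∈ A, ∃ z ∈ T, dist x z ≤ 2 * ρ := by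
  classical
  have card_le : ∀ T : Finset X, ↑T ⊆ A → (T : Set X).Pairwise (fun x z => 2 * ρ < dist x z) →
      (T.card : ℝ) * c ≤ 1 := by
    intro T hT hsep
    have hdisj : (T : Set X).PairwiseDisjoint (fun x => closedBall x ρ) := by
      intro x hx z hz hxz
      exact closedBall_disjoint_closedBall (by linarith [hsep hx hz hxz])
    calc (T.card : ℝ) * c = ∑ x ∈ T, c := by simp
      _ ≤ ∑ x ∈ T, μ.real (closedBall x ρ) := Finset.sum_le_sum fun x hx => hA x (hT hx)
      _ = μ.real (⋃ x ∈ T, closedBall x ρ) :=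
        (measureReal_biUnion_finset hdisj fun x _ => measurableSet_closedBall).symm
      _ ≤ 1 := measureReal_le_one
  let S : Set ℕ := {n | ∃ T : Finset X, ↑T ⊆ A ∧
    (T : Set X).Pairwise (fun x z => 2 * ρ < dist x z) ∧ T.card = n}
  have hne : S.Nonempty := ⟨0, ∅, by simp, by simp, by simp⟩
  have hbdd : BddAbove S := by
    refine ⟨⌊1 / c⌋₊, ?_⟩
    rintro n ⟨T, hT, hsep, rfl⟩
    exact Nat.le_floor ((le_div_iff₀ hc).2 (card_le T hT hsep))
  obtain ⟨T, hT, hsep, hcard⟩ := Nat.sSup_mem hne hbdd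
  refine ⟨T, hT, card_le T hT hsep, fun x hx => ?_⟩
  by_contra! hfar
  have hxT : x ∉ T := fun h => by
    have := hfar x h
    rw [dist_self] at this
    linarith
  have hins : T.card + 1 ∈ S := by
    refine ⟨insert x T, ?_, ?_, Finset.card_insert_of_notMem hxT⟩
    · rw [Finset.coe_insert]
      exact insert_subset hx hT
    · rw [Finset.coe_insert]
      refine hsep.insert fun z hz _ => ⟨hfar z hz, ?_⟩
      rw [dist_comm]
      exact hfar z hz
  have := le_csSup hbdd hins
  omega

section PseudoDTM

variable {d : ℕ} {μ : Measure (Euc d)} {u v : ℝ}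

lemma pseudoDTM_nonneg (u : ℝ) (x : Euc d) : 0 ≤ pseudoDTM μ u x :=
  Real.sInf_nonneg fun _ hr => hr.1.le

lemma bddBelow_pseudoDTM (u : ℝ) (x : Euc d) :
    BddBelow {r : ℝ | 0 < r ∧ u < (μ (ball x r)).toReal} := ⟨0, fun _ hr => hr.1.le⟩

variable [IsProbabilityMeasure μ]

lemma nonempty_pseudoDTM (hu : u < 1) (x : Euc d) :
    {r : ℝ | 0 < r ∧ u < (μ (ball x r)).toReal}.Nonempty := by
  have hmono : Monotone fun n : ℕ => ball x (n : ℝ) := fun a b hab =>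
    ball_subset_ball (by exact_mod_cast hab)
  have h := tendsto_measure_iUnion_atTop (μ := μ) hmono
  rw [iUnion_ball_nat, measure_univ] at h
  have h' := (ENNReal.tendsto_toReal ENNReal.one_ne_top).comp h
  rw [ENNReal.toReal_one] at h'
  obtain ⟨n, hn, hn0⟩ :=
    ((h'.eventually (lt_mem_nhds hu)).and (Filter.eventually_gt_atTop 0)).exists
  exact ⟨n, by exact_mod_cast hn0, hn⟩

lemma pseudoDTM_mono (huv : u ≤ v) (hv : v < 1) (x : Euc d) :
    pseudoDTM μ u x ≤ pseudoDTM μ v x :=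
  csInf_le_csInf (bddBelow_pseudoDTM u x) (nonempty_pseudoDTM hv x)
    fun _ hr => ⟨hr.1, huv.trans_lt hr.2⟩

lemma pseudoDTM_le_add_dist (hu : u < 1) (x y : Euc d) :
    pseudoDTM μ u x ≤ pseudoDTM μ u y + dist x y := by
  rw [← sub_le_iff_le_add]
  refine le_csInf (nonempty_pseudoDTM hu y) fun r hr => ?_
  rw [sub_le_iff_le_add]
  refine csInf_le (bddBelow_pseudoDTM u x) ⟨by linarith [hr.1, dist_nonneg (x := x) (y := y)], ?_⟩
  refine hr.2.trans_le (ENNReal.toReal_mono (measure_ne_top _ _) (measure_mono ?_))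
  exact ball_subset_ball' (by rw [dist_comm y x])

lemma le_measureReal_closedBall (hu : u < 1) {x : Euc d} {r : ℝ} (hr : pseudoDTM μ u x ≤ r) :
    u ≤ μ.real (closedBall x r) := by
  have hlt : ∀ n : ℕ, u ≤ μ.real (closedBall x (r + 1 / (n + 1))) := by
    intro n
    obtain ⟨s, hs, hsr⟩ := exists_lt_of_csInf_lt (nonempty_pseudoDTM hu x)
      (hr.trans_lt (lt_add_of_pos_right r (Nat.one_div_pos_of_nat (n := n))))
    exact hs.2.le.trans (measureReal_mono (ball_subset_closedBall.trans
      (closedBall_subset_closedBall hsr.le)))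
  have hanti : Antitone fun n : ℕ => closedBall x (r + 1 / ((n : ℝ) + 1)) := fun a b hab =>
    closedBall_subset_closedBall (by gcongr)
  have hInter : ⋂ n : ℕ, closedBall x (r + 1 / ((n : ℝ) + 1)) = closedBall x r := by
    ext z
    simp only [mem_iInter, mem_closedBall]
    refine ⟨fun h => ?_, fun h n => h.trans (le_add_of_nonneg_right (by positivity))⟩
    have ht := (tendsto_one_div_add_atTop_nhds_zero_nat (𝕜 := ℝ)).const_add r
    rw [add_zero] at ht
    exact ge_of_tendsto' ht h
  have h := tendsto_measure_iInter_atTop (μ := μ)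
    (fun n : ℕ => (measurableSet_closedBall (x := x) (ε := r + 1 / ((n : ℝ) + 1))).nullMeasurableSet)
    hanti ⟨0, measure_ne_top _ _⟩
  rw [hInter] at h
  exact ge_of_tendsto' ((ENNReal.tendsto_toReal (measure_ne_top _ _)).comp h) hlt

end PseudoDTM

section DTM

variable {d : ℕ} {m p : ℝ} {μ : Measure (Euc d)}

/-- The uniform probability measure on `(0, m]`. -/
def uniformIoc (m : ℝ) : Measure ℝ := ENNReal.ofReal (1 / m) • volume.restrict (Ioc 0 m)

lemma isProbabilityMeasure_uniformIoc (hm : 0 < m) : IsProbabilityMeasure (uniformIoc m) := by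
  constructor
  rw [uniformIoc, Measure.smul_apply, Measure.restrict_apply_univ, Real.volume_Ioc, sub_zero,
    smul_eq_mul, ← ENNReal.ofReal_mul (by positivity), one_div_mul_cancel hm.ne',
    ENNReal.ofReal_one]

lemma ae_uniformIoc {P : ℝ → Prop} (h : ∀ u ∈ Ioc 0 m, P u) : ∀ᵐ u ∂uniformIoc m, P u :=
  Measure.ae_smul_measure (ae_restrict_of_forall_mem measurableSet_Ioc h) _

variable [IsProbabilityMeasure μ]

lemma memLp_pseudoDTM (hm : m ∈ Ioo (0 : ℝ) 1) (q : ℝ≥0∞) (x : Euc d) :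
    MemLp (fun u => pseudoDTM μ u x) q (uniformIoc m) := by
  have := isProbabilityMeasure_uniformIoc hm.1
  refine MemLp.of_bound (AEMeasurable.aestronglyMeasurable ?_) (pseudoDTM μ m x)
    (ae_uniformIoc fun u hu => ?_)
  · refine AEMeasurable.smul_measure (aemeasurable_restrict_of_monotoneOn measurableSet_Ioc ?_) _
    exact fun a _ b hb hab => pseudoDTM_mono hab (hb.2.trans_lt hm.2) x
  · rw [Real.norm_of_nonneg (pseudoDTM_nonneg u x)]
    exact pseudoDTM_mono hu.2 hm.2 x

lemma dtm_eq_toReal_eLpNorm (hm : m ∈ Ioo (0 : ℝ) 1) (hp : 1 ≤ p) (x : Euc d) :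
    dtm m p μ x =
      (eLpNorm (fun u => pseudoDTM μ u x) (ENNReal.ofReal p) (uniformIoc m)).toReal := by
  have hp0 : 0 < p := by linarith
  have hm0 := hm.1
  rw [(memLp_pseudoDTM hm _ x).eLpNorm_eq_integral_rpow_norm (by simpa using hp0)
    ENNReal.ofReal_ne_top, ENNReal.toReal_ofReal (by positivity), ENNReal.toReal_ofReal hp0.le,
    uniformIoc, integral_smul_measure, ENNReal.toReal_ofReal (by positivity), dtm, one_div p]
  simp only [Real.norm_of_nonneg (pseudoDTM_nonneg _ x), smul_eq_mul]

lemma dtm_nonneg (hm : m ∈ Ioo (0 : ℝ) 1) (hp : 1 ≤ p) (x : Euc d) : 0 ≤ dtm m p μ x := by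
  rw [dtm_eq_toReal_eLpNorm hm hp]
  exact ENNReal.toReal_nonneg

lemma lipschitzWith_dtm (hm : m ∈ Ioo (0 : ℝ) 1) (hp : 1 ≤ p) :
    LipschitzWith 1 (dtm m p μ : Euc d → ℝ) := by
  have := isProbabilityMeasure_uniformIoc hm.1
  refine LipschitzWith.of_le_add fun x y => ?_
  have hp' : 1 ≤ ENNReal.ofReal p := by simpa using hp
  rw [dtm_eq_toReal_eLpNorm hm hp, dtm_eq_toReal_eLpNorm hm hp]
  have hconst : eLpNorm (fun _ : ℝ => dist x y) (ENNReal.ofReal p) (uniformIoc m) =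
      ENNReal.ofReal (dist x y) := by
    rw [eLpNorm_const _ (by positivity) (IsProbabilityMeasure.ne_zero _), measure_univ,
      ENNReal.one_rpow, mul_one, Real.enorm_of_nonneg dist_nonneg]
  have h1 : eLpNorm (fun u => pseudoDTM μ u x) (ENNReal.ofReal p) (uniformIoc m) ≤
      eLpNorm ((fun u => pseudoDTM μ u y) + fun _ => dist x y) (ENNReal.ofReal p)
        (uniformIoc m) := by
    refine eLpNorm_mono_ae_real (ae_uniformIoc fun u hu => ?_)
    rw [Real.norm_of_nonneg (pseudoDTM_nonneg u x)]
    exact pseudoDTM_le_add_dist (hu.2.trans_lt hm.2) x y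
  have h2 := h1.trans (eLpNorm_add_le (memLp_pseudoDTM hm 1 y).1 aestronglyMeasurable_const hp')
  rw [hconst] at h2
  have hfin := (memLp_pseudoDTM (μ := μ) hm (ENNReal.ofReal p) y).2.ne
  have h3 := ENNReal.toReal_mono (by finiteness) h2
  rwa [ENNReal.toReal_add hfin ENNReal.ofReal_ne_top, ENNReal.toReal_ofReal dist_nonneg] at h3

lemma pseudoDTM_half_le_two_mul_dtm (hm : m ∈ Ioo (0 : ℝ) 1) (hp : 1 ≤ p) (x : Euc d) :
    pseudoDTM μ (m / 2) x ≤ 2 * dtm m p μ x := by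
  have hm0 := hm.1
  have := isProbabilityMeasure_uniformIoc hm.1
  have hp' : 1 ≤ ENNReal.ofReal p := by simpa using hp
  have hL := memLp_pseudoDTM (μ := μ) hm 1 x
  have h1 : eLpNorm (fun u => pseudoDTM μ u x) 1 (uniformIoc m) ≤
      eLpNorm (fun u => pseudoDTM μ u x) (ENNReal.ofReal p) (uniformIoc m) :=
    eLpNorm_le_eLpNorm_of_exponent_le hp' hL.1
  have h2 := ENNReal.toReal_mono (memLp_pseudoDTM (μ := μ) hm (ENNReal.ofReal p) x).2.ne h1
  rw [← dtm_eq_toReal_eLpNorm hm hp, ← ENNReal.ofReal_one, ← dtm_eq_toReal_eLpNorm hm le_rfl]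
    at h2
  have hint : IntegrableOn (fun u => pseudoDTM μ u x) (Ioc 0 m) := by
    have h := hL.integrable le_rfl
    rw [uniformIoc, integrable_smul_measure (by simpa using hm.1) ENNReal.ofReal_ne_top] at h
    exact h
  have hsub : Ioc (m / 2) m ⊆ Ioc 0 m := Ioc_subset_Ioc_left (by positivity)
  have h3 : m / 2 * pseudoDTM μ (m / 2) x ≤ ∫ u in Ioc 0 m, pseudoDTM μ u x :=
    calc m / 2 * pseudoDTM μ (m / 2) x = ∫ u in Ioc (m / 2) m, pseudoDTM μ (m / 2) x := by
          rw [setIntegral_const, Real.volume_real_Ioc_of_le (by linarith), smul_eq_mul]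
          ring
      _ ≤ ∫ u in Ioc (m / 2) m, pseudoDTM μ u x :=
          setIntegral_mono_on (by simp) (hint.mono_set hsub) measurableSet_Ioc
            fun u hu => pseudoDTM_mono hu.1.le (hu.2.trans_lt hm.2) x
      _ ≤ ∫ u in Ioc 0 m, pseudoDTM μ u x :=
          setIntegral_mono_set hint (ae_of_all _ fun u => pseudoDTM_nonneg u x)
            hsub.eventuallyLE
  have h4 : dtm m 1 μ x = (∫ u in Ioc 0 m, pseudoDTM μ u x) / m := by
    simp [dtm, div_eq_inv_mul]
  rw [h4, div_le_iff₀ hm.1] at h2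
  have : m * pseudoDTM μ (m / 2) x ≤ m * (2 * dtm m p μ x) := by linarith
  exact le_of_mul_le_mul_left this hm.1

/-- The sublevel set `{d_μ ≤ r}` is covered by at most `2 / m` balls of radius `4 * r`. -/
lemma exists_finset_cover_dtm_le (hm : m ∈ Ioo (0 : ℝ) 1) (hp : 1 ≤ p) {r : ℝ} (hr : 0 ≤ r) :
    ∃ T : Finset (Euc d), (∀ z ∈ T, dtm m p μ z ≤ r) ∧ (T.card : ℝ) ≤ 2 / m ∧
      ∀ x, dtm m p μ x ≤ r → ∃ z ∈ T, dist x z ≤ 4 * r := by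
  have hm0 := hm.1
  have hm1 := hm.2
  obtain ⟨T, hT, hcard, hcov⟩ := exists_finset_cover_of_measure_closedBall μ
    (A := {x | dtm m p μ x ≤ r}) (ρ := 2 * r) (c := m / 2) (by positivity) (by positivity)
    fun x (hx : dtm m p μ x ≤ r) => le_measureReal_closedBall (by linarith)
      ((pseudoDTM_half_le_two_mul_dtm hm hp x).trans (by linarith))
  refine ⟨T, fun z hz => hT hz, ?_, fun x hx => ?_⟩
  · rw [le_div_iff₀ hm.1]
    linarith
  · obtain ⟨z, hz, h⟩ := hcov x hx
    exact ⟨z, hz, by linarith⟩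

end DTM

section Path

variable {E : Type*} [NormedAddCommGroup E] [NormedSpace ℝ E]

/-- The path obtained from `γ` by replacing its restriction to `[a, b]` by a straight segment. -/
def straighten (γ : ℝ → E) (a b t : ℝ) : E :=
  γ (min t a) + (γ (max t b) - γ b) +
    ((min (max t a) b - a) / (b - a)) • (γ b - γ a)

lemma straighten_of_le {γ : ℝ → E} {a b t : ℝ} (hab : a < b) (ht : t ≤ a) :
    straighten γ a b t = γ t := by
  simp [straighten, ht, ht.trans hab.le, hab.le]

lemma straighten_of_ge {γ : ℝ → E} {a b t : ℝ} (hab : a < b) (ht : b ≤ t) :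
    straighten γ a b t = γ t := by
  simp [straighten, ht, hab.le.trans ht, div_self (sub_ne_zero.2 hab.ne')]
  abel

lemma straighten_of_mem {γ : ℝ → E} {a b t : ℝ} (ht : t ∈ Icc a b) :
    straighten γ a b t = γ a + ((t - a) / (b - a)) • (γ b - γ a) := by
  simp [straighten, ht.1, ht.2]

lemma exists_lipschitzWith_straighten {γ : ℝ → E} {K : ℝ≥0} (hγ : LipschitzWith K γ) {a b : ℝ} :
    ∃ K', LipschitzWith K' (straighten γ a b) := by
  have h1 := hγ.comp ((LipschitzWith.id (α := ℝ)).min_const a)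
  have h2 := hγ.comp ((LipschitzWith.id (α := ℝ)).max_const b)
  have h3 := ((LipschitzWith.id (α := ℝ)).max_const a).min_const b
  have h4 : LipschitzWith ‖(b - a)⁻¹ • (γ b - γ a)‖₊ fun s : ℝ =>
      s • ((b - a)⁻¹ • (γ b - γ a)) := by
    refine LipschitzWith.of_dist_le_mul fun s t => ?_
    rw [dist_eq_norm, ← sub_smul, norm_smul, mul_comm, dist_eq_norm, coe_nnnorm]
  have h5 := (((h1.add h2).add (h4.comp h3))).add
    (LipschitzWith.const (-γ b - (a / (b - a)) • (γ b - γ a)))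
  suffices h : straighten γ a b = fun t => γ (min t a) + γ (max t b) +
      min (max t a) b • ((b - a)⁻¹ • (γ b - γ a)) + (-γ b - (a / (b - a)) • (γ b - γ a)) by
    rw [h]
    exact ⟨_, h5⟩
  ext t
  rw [straighten, sub_div, sub_smul, div_eq_mul_inv (min _ _), mul_smul]
  abel

lemma straighten_mem {γ : ℝ → E} {a b t : ℝ} {B : Set E} (hB : Convex ℝ B) (ha : γ a ∈ B)
    (hb : γ b ∈ B) (ht : t ∈ Ioo a b) : straighten γ a b t ∈ B := by
  have hab : 0 < b - a := by linarith [ht.1, ht.2]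
  rw [straighten_of_mem ⟨ht.1.le, ht.2.le⟩]
  refine hB.add_smul_sub_mem ha hb ⟨div_nonneg (by linarith [ht.1]) hab.le, ?_⟩
  rw [div_le_one hab]
  linarith [ht.2]

lemma deriv_straighten_of_mem {γ : ℝ → E} {a b t : ℝ} (ht : t ∈ Ioo a b) :
    deriv (straighten γ a b) t = (1 / (b - a)) • (γ b - γ a) := by
  have h : straighten γ a b =ᶠ[nhds t] fun s => γ a + ((s - a) / (b - a)) • (γ b - γ a) := by
    filter_upwards [Ioo_mem_nhds ht.1 ht.2] with s hs
    exact straighten_of_mem ⟨hs.1.le, hs.2.le⟩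
  rw [h.deriv_eq]
  exact (((((hasDerivAt_id t).sub_const a).div_const (b - a)).smul_const
    (γ b - γ a)).const_add (γ a)).deriv

lemma deriv_straighten_of_notMem {γ : ℝ → E} {a b t : ℝ} (hab : a < b) (ht : t ∉ Icc a b) :
    deriv (straighten γ a b) t = deriv γ t := by
  refine Filter.EventuallyEq.deriv_eq ?_
  rcases lt_or_ge t a with h | h
  · filter_upwards [Iio_mem_nhds h] with s hs using straighten_of_le hab hs.le
  · have h' : b < t := lt_of_not_ge fun h' => ht ⟨h, h'⟩
    filter_upwards [Ioi_mem_nhds h'] with s hs using straighten_of_ge hab hs.le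

lemma integrableOn_weight_mul_norm_deriv [FiniteDimensional ℝ E] {w : E → ℝ} (hw : Continuous w)
    {γ : ℝ → E} {K : ℝ≥0} (hγ : LipschitzWith K γ) (a b : ℝ) :
    IntegrableOn (fun t => w (γ t) * ‖deriv γ t‖) (Icc a b) := by
  borelize E
  have : CompleteSpace E := FiniteDimensional.complete ℝ E
  refine IntegrableOn.continuousOn_mul (hw.comp hγ.continuous).continuousOn ?_ isCompact_Icc
  refine Measure.integrableOn_of_bounded (M := K) (by simp)
    (measurable_deriv γ).norm.aestronglyMeasurable (ae_of_all _ fun t => ?_)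
  rw [norm_norm]
  exact norm_deriv_le_of_lipschitz hγ

/-- A path minimising a weighted length has, between two of its points lying in a convex set where
the weight is at most `C`, weighted length at most `C` times the distance of these points. -/
lemma setIntegral_weight_le_of_minimizing [FiniteDimensional ℝ E] {w : E → ℝ} (hw : Continuous w)
    {γ : ℝ → E} {K : ℝ≥0} (hγ : LipschitzWith K γ)
    (hmin : ∀ η : ℝ → E, (∃ K', LipschitzWith K' η) → η 0 = γ 0 → η 1 = γ 1 →
      ∫ t in Icc (0 : ℝ) 1, w (γ t) * ‖deriv γ t‖ ≤ ∫ t in Icc (0 : ℝ) 1, w (η t) * ‖deriv η t‖)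
    {a b : ℝ} (ha : 0 ≤ a) (hab : a < b) (hb : b ≤ 1) {B : Set E} (hB : Convex ℝ B)
    (haB : γ a ∈ B) (hbB : γ b ∈ B) {C : ℝ} (hC : ∀ x ∈ B, w x ≤ C) :
    ∫ t in Icc a b, w (γ t) * ‖deriv γ t‖ ≤ C * ‖γ b - γ a‖ := by
  set η := straighten γ a b with hη
  obtain ⟨K', hK'⟩ := exists_lipschitzWith_straighten hγ (a := a) (b := b)
  have hle := hmin η ⟨K', hK'⟩ (straighten_of_le hab ha) (straighten_of_ge hab hb)
  have hsub : Icc a b ⊆ Icc 0 1 := Icc_subset_Icc ha hb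
  have hγi := integrableOn_weight_mul_norm_deriv hw hγ 0 1
  have hηi := integrableOn_weight_mul_norm_deriv hw hK' 0 1
  rw [← integral_inter_add_sdiff measurableSet_Icc hγi,
    ← integral_inter_add_sdiff (measurableSet_Icc (a := a) (b := b)) hηi,
    inter_eq_right.2 hsub] at hle
  have hdiff : ∫ t in Icc 0 1 \ Icc a b, w (η t) * ‖deriv η t‖ =
      ∫ t in Icc 0 1 \ Icc a b, w (γ t) * ‖deriv γ t‖ := by
    refine setIntegral_congr_fun (measurableSet_Icc.diff measurableSet_Icc) fun t ht => ?_
    have h : η t = γ t := by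
      rcases lt_or_ge t a with h | h
      · exact straighten_of_le hab h.le
      · exact straighten_of_ge hab (le_of_not_ge fun h' => ht.2 ⟨h, h'⟩)
    simp only [h]
    rw [hη, deriv_straighten_of_notMem hab ht.2]
  have hseg : ∫ t in Icc a b, w (η t) * ‖deriv η t‖ ≤ C * ‖γ b - γ a‖ := by
    rw [integral_Icc_eq_integral_Ioo]
    calc ∫ t in Ioo a b, w (η t) * ‖deriv η t‖
        ≤ ∫ t in Ioo a b, C * ((1 / (b - a)) * ‖γ b - γ a‖) := by
          refine setIntegral_mono_on (hηi.mono_set (Ioo_subset_Icc_self.trans hsub))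
            (integrableOn_const (by simp))
            measurableSet_Ioo fun t ht => ?_
          rw [hη, deriv_straighten_of_mem ht, norm_smul, Real.norm_of_nonneg
            (one_div_nonneg.2 (sub_nonneg.2 hab.le))]
          have := hC _ (straighten_mem hB haB hbB ht)
          have : 0 ≤ 1 / (b - a) := one_div_nonneg.2 (sub_nonneg.2 hab.le)
          gcongr
      _ = C * ‖γ b - γ a‖ := by
          have : b - a ≠ 0 := sub_ne_zero.2 hab.ne'
          rw [setIntegral_const, Real.volume_real_Ioo_of_le hab.le, smul_eq_mul]
          field_simp
  linarith

/-- The derivative of a path vanishes almost everywhere on each fibre. -/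
lemma ae_deriv_eq_zero_of_eq (γ : ℝ → E) (z : E) : ∀ᵐ t, γ t = z → deriv γ t = 0 := by
  have hcount : {t | t ∈ γ ⁻¹' {z} ∧ nhdsWithin t (γ ⁻¹' {z} ∩ Ioi t) = ⊥}.Countable :=
    countable_setOfPred_isolated_right_within
  filter_upwards [hcount.ae_notMem volume] with t ht htz
  by_contra hne
  refine ht ⟨htz, ?_⟩
  have h := (differentiableAt_of_deriv_ne_zero hne).hasDerivAt.eventually_ne (c := z) hne
  have hmono : nhdsWithin t (γ ⁻¹' {z} ∩ Ioi t) ≤ nhdsWithin t {t}ᶜ :=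
    nhdsWithin_mono t fun s hs => (ne_of_gt hs.2 : s ≠ t)
  have h1 := h.filter_mono hmono
  have h2 : ∀ᶠ s in nhdsWithin t (γ ⁻¹' {z} ∩ Ioi t), s ∈ γ ⁻¹' {z} ∩ Ioi t :=
    self_mem_nhdsWithin
  rw [← Filter.eventually_false_iff_eq_bot]
  filter_upwards [h1, h2] with s hs hs' using hs hs'.1

end Path

section LengthMeasure

variable {E : Type*} [NormedAddCommGroup E] [NormedSpace ℝ E]

/-- The measure on the parameter space giving the Euclidean length of the pieces of `γ`. -/
def lengthMeasure (γ : ℝ → E) : Measure ℝ := volume.withDensity fun t => ‖deriv γ t‖ₑ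

lemma lengthMeasure_eq_ofReal_integral [FiniteDimensional ℝ E] {γ : ℝ → E} {K : ℝ≥0}
    (hγ : LipschitzWith K γ) {s : Set ℝ} (hs : MeasurableSet s) {a b : ℝ} (hsub : s ⊆ Icc a b) :
    lengthMeasure γ s = ENNReal.ofReal (∫ t in s, ‖deriv γ t‖) := by
  borelize E
  have : CompleteSpace E := FiniteDimensional.complete ℝ E
  have hint : IntegrableOn (deriv γ) (Icc a b) := Measure.integrableOn_of_bounded (M := K) (by simp)
    (stronglyMeasurable_deriv γ).aestronglyMeasurable
    (ae_of_all _ fun t => norm_deriv_le_of_lipschitz hγ)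
  rw [lengthMeasure, withDensity_apply _ hs,
    ofReal_integral_norm_eq_lintegral_enorm (hint.mono_set hsub)]

lemma lengthMeasure_preimage_singleton {γ : ℝ → E} (hγ : Continuous γ)
    (z : E) : lengthMeasure γ (γ ⁻¹' {z}) = 0 := by
  have hs : MeasurableSet (γ ⁻¹' {z}) := (isClosed_singleton.preimage hγ).measurableSet
  rw [lengthMeasure, withDensity_apply _ hs]
  refine lintegral_eq_zero_of_ae_eq_zero ((ae_restrict_iff' hs).2 ?_)
  filter_upwards [ae_deriv_eq_zero_of_eq γ z] with t ht htz
  simp [ht htz]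

end LengthMeasure

section Minimizing

variable {d : ℕ} {m p β : ℝ} {μ : Measure (Euc d)} [IsProbabilityMeasure μ] {γ : ℝ → Euc d}

lemma continuous_dtm_rpow (hm : m ∈ Ioo (0 : ℝ) 1) (hp : 1 ≤ p) (hβ : 1 ≤ β) :
    Continuous fun x : Euc d => dtm m p μ x ^ β :=
  (lipschitzWith_dtm hm hp).continuous.rpow_const fun _ => Or.inr (by linarith)

lemma lengthMeasure_dtm_eq_zero (hm : m ∈ Ioo (0 : ℝ) 1) (hp : 1 ≤ p) (hγ : Continuous γ) :
    lengthMeasure γ {t | dtm m p μ (γ t) = 0} = 0 := by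
  obtain ⟨T, -, -, hcov⟩ := exists_finset_cover_dtm_le (μ := μ) hm hp le_rfl
  refine measure_mono_null (t := ⋃ z ∈ T, γ ⁻¹' {z}) (fun t ht => ?_)
    ((measure_biUnion_null_iff T.countable_toSet).2
      fun z _ => lengthMeasure_preimage_singleton hγ z)
  obtain ⟨z, hz, hdist⟩ := hcov (γ t) (le_of_eq ht)
  exact mem_biUnion hz (dist_le_zero.1 (by simpa using hdist))

/-- Length of a minimising path within a ball and a level set of the distance-to-measure. -/
lemma lengthMeasure_level_inter_ball_le (hm : m ∈ Ioo (0 : ℝ) 1) (hp : 1 ≤ p) (hβ : 1 ≤ β)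
    (hlip : IsLipschitzPath γ)
    (hmin : ∀ η : ℝ → Euc d, IsLipschitzPath η → η 0 = γ 0 → η 1 = γ 1 →
      fdtmLength m p β μ γ ≤ fdtmLength m p β μ η)
    {r : ℝ} (hr : 0 < r) {z : Euc d} (hz : dtm m p μ z ≤ r) :
    lengthMeasure γ (Icc 0 1 ∩ {t | r * 2 ^ (-(1 / β)) < dtm m p μ (γ t)} ∩
      γ ⁻¹' closedBall z (4 * r)) ≤ ENNReal.ofReal (16 * 5 ^ β * r) := by
  obtain ⟨K, hK⟩ := hlip
  have hβ0 : 0 < β := by linarith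
  have hcont : Continuous fun t => dtm m p μ (γ t) :=
    (lipschitzWith_dtm hm hp).continuous.comp hK.continuous
  set P := Icc (0 : ℝ) 1 ∩ γ ⁻¹' closedBall z (4 * r) with hP
  set S := Icc 0 1 ∩ {t | r * 2 ^ (-(1 / β)) < dtm m p μ (γ t)} ∩ γ ⁻¹' closedBall z (4 * r)
    with hS
  have hSP : S ⊆ P := fun t ht => ⟨ht.1.1, ht.2⟩
  have hPc : IsCompact P := isCompact_Icc.inter_right (isClosed_closedBall.preimage hK.continuous)
  have hSm : MeasurableSet S := (measurableSet_Icc.inter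
    (isOpen_lt continuous_const hcont).measurableSet).inter
    (isClosed_closedBall.preimage hK.continuous).measurableSet
  rcases P.eq_empty_or_nonempty with hPe | hPne
  · rw [subset_eq_empty hSP hPe, measure_empty]
    exact zero_le
  have haP := hPc.sInf_mem hPne
  have hbP := hPc.sSup_mem hPne
  set a := sInf P
  set b := sSup P
  have hPab : P ⊆ Icc a b := fun t ht => ⟨csInf_le hPc.bddBelow ht, le_csSup hPc.bddAbove ht⟩
  rcases (hPab haP).2.eq_or_lt with hab | hab
  · refine (measure_mono_null (hSP.trans hPab) ?_).trans_le (zero_le)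
    rw [← hab, Icc_self]
    exact withDensity_absolutelyContinuous _ _ (by simp)
  rw [lengthMeasure_eq_ofReal_integral hK hSm (hSP.trans hPab)]
  refine ENNReal.ofReal_le_ofReal ?_
  have hbound : ∀ x ∈ closedBall z (4 * r), dtm m p μ x ^ β ≤ (5 * r) ^ β := by
    intro x hx
    refine Real.rpow_le_rpow (dtm_nonneg hm hp x) ?_ hβ0.le
    have h := (lipschitzWith_dtm (μ := μ) hm hp).dist_le_mul x z
    rw [NNReal.coe_one, one_mul, Real.dist_eq] at h
    linarith [le_abs_self (dtm m p μ x - dtm m p μ z), mem_closedBall.1 hx]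
  have hseg := setIntegral_weight_le_of_minimizing (continuous_dtm_rpow (μ := μ) hm hp hβ) hK hmin
    haP.1.1 hab hbP.1.2 (convex_closedBall z (4 * r)) haP.2 hbP.2 hbound
  have hdist : ‖γ b - γ a‖ ≤ 8 * r := by
    rw [← dist_eq_norm]
    linarith [dist_triangle_right (γ b) (γ a) z, mem_closedBall.1 haP.2, mem_closedBall.1 hbP.2]
  have hint := integrableOn_weight_mul_norm_deriv (continuous_dtm_rpow (μ := μ) hm hp hβ) hK a b
  have hint' := integrableOn_weight_mul_norm_deriv (w := fun _ => r ^ β / 2)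
    continuous_const hK a b
  have hlow : r ^ β / 2 * ∫ t in S, ‖deriv γ t‖ ≤
      ∫ t in Icc a b, dtm m p μ (γ t) ^ β * ‖deriv γ t‖ := by
    rw [← integral_const_mul]
    refine (setIntegral_mono_on (hint'.mono_set (hSP.trans hPab)) (hint.mono_set (hSP.trans hPab))
      hSm fun t ht => ?_).trans (setIntegral_mono_set hint
        (ae_of_all _ fun t => mul_nonneg (Real.rpow_nonneg (dtm_nonneg hm hp _) _) (norm_nonneg _))
        (hSP.trans hPab).eventuallyLE)
    refine mul_le_mul_of_nonneg_right ?_ (norm_nonneg _)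
    calc r ^ β / 2 = (r * 2 ^ (-(1 / β))) ^ β := by
          rw [Real.mul_rpow hr.le (by positivity), ← Real.rpow_mul (by norm_num), neg_mul,
            one_div_mul_cancel hβ0.ne', Real.rpow_neg_one, div_eq_mul_inv]
      _ ≤ dtm m p μ (γ t) ^ β := Real.rpow_le_rpow (by positivity) (le_of_lt ht.1.2) hβ0.le
  have hrβ : 0 < r ^ β := by positivity
  have h5 : (5 * r) ^ β * ‖γ b - γ a‖ ≤ 5 ^ β * r ^ β * (8 * r) := by
    rw [Real.mul_rpow (by norm_num) hr.le]
    gcongr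
  have : r ^ β / 2 * ∫ t in S, ‖deriv γ t‖ ≤ r ^ β / 2 * (16 * 5 ^ β * r) := by
    linarith
  exact le_of_mul_le_mul_left this (by positivity)

/-- Length of a minimising path within a level set of the distance-to-measure. -/
lemma lengthMeasure_level_le (hm : m ∈ Ioo (0 : ℝ) 1) (hp : 1 ≤ p) (hβ : 1 ≤ β)
    (hlip : IsLipschitzPath γ)
    (hmin : ∀ η : ℝ → Euc d, IsLipschitzPath η → η 0 = γ 0 → η 1 = γ 1 →
      fdtmLength m p β μ γ ≤ fdtmLength m p β μ η)
    {r : ℝ} (hr : 0 < r) :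
    lengthMeasure γ {t | t ∈ Icc 0 1 ∧ r * 2 ^ (-(1 / β)) < dtm m p μ (γ t) ∧
      dtm m p μ (γ t) ≤ r} ≤ ENNReal.ofReal (32 * 5 ^ β / m * r) := by
  obtain ⟨T, hT, hcard, hcov⟩ := exists_finset_cover_dtm_le (μ := μ) hm hp hr.le
  calc _ ≤ lengthMeasure γ (⋃ z ∈ T, Icc 0 1 ∩ {t | r * 2 ^ (-(1 / β)) < dtm m p μ (γ t)} ∩
        γ ⁻¹' closedBall z (4 * r)) := by
        refine measure_mono fun t ht => ?_
        obtain ⟨z, hz, hdist⟩ := hcov (γ t) ht.2.2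
        exact mem_biUnion hz ⟨⟨ht.1, ht.2.1⟩, hdist⟩
    _ ≤ ∑ z ∈ T, lengthMeasure γ (Icc 0 1 ∩ {t | r * 2 ^ (-(1 / β)) < dtm m p μ (γ t)} ∩
        γ ⁻¹' closedBall z (4 * r)) := measure_biUnion_finset_le _ _
    _ ≤ ∑ z ∈ T, ENNReal.ofReal (16 * 5 ^ β * r) := Finset.sum_le_sum fun z hz =>
        lengthMeasure_level_inter_ball_le hm hp hβ hlip hmin hr (hT z hz)
    _ = ENNReal.ofReal (T.card * (16 * 5 ^ β * r)) := by
        rw [Finset.sum_const, nsmul_eq_mul,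
          ENNReal.ofReal_mul (p := (T.card : ℝ)) (by positivity), ENNReal.ofReal_natCast]
    _ ≤ ENNReal.ofReal (32 * 5 ^ β / m * r) := by
        refine ENNReal.ofReal_le_ofReal ?_
        calc _ ≤ 2 / m * (16 * 5 ^ β * r) := by gcongr
          _ = _ := by ring

end Minimizing

lemma inv_one_sub_two_rpow_le {β : ℝ} (hβ : 1 ≤ β) :
    (1 - (2 : ℝ) ^ (-(1 / β)))⁻¹ ≤ 2 * β / Real.log 2 := by
  have hβ0 : 0 < β := by linarith
  have hlog : 0 < Real.log 2 := Real.log_pos one_lt_two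
  have hlog1 : Real.log 2 ≤ 1 := by linarith [Real.log_two_lt_d9]
  set s := Real.log 2 / β with hs
  have hs0 : 0 < s := by positivity
  have hs1 : s ≤ 1 := (div_le_one hβ0).2 (hlog1.trans hβ)
  have hq : (2 : ℝ) ^ (-(1 / β)) ≤ 1 / (1 + s) := by
    have h : Real.log 2 * -(1 / β) = -s := by rw [hs]; ring
    rw [Real.rpow_def_of_pos two_pos, h, Real.exp_neg, ← one_div]
    exact one_div_le_one_div_of_le (by positivity) (by linarith [Real.add_one_le_exp s])
  have hq' : 1 / (1 + s) ≤ 1 - s / 2 := by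
    rw [div_le_iff₀ (by positivity)]
    nlinarith
  calc (1 - (2 : ℝ) ^ (-(1 / β)))⁻¹ ≤ (s / 2)⁻¹ := inv_anti₀ (by positivity) (by linarith)
    _ = 2 * β / Real.log 2 := by rw [hs]; field_simp

theorem eucLength_geodesic_le_no_domain {d : ℕ} (m p β : ℝ) (hm : m ∈ Set.Ioo (0 : ℝ) 1)
    (hp : 1 ≤ p) (hβ : 1 ≤ β) (μ : Measure (Euc d)) [IsProbabilityMeasure μ]
    (x y : Euc d) (γ : ℝ → Euc d) (hlip : IsLipschitzPath γ) (h0 : γ 0 = x) (h1 : γ 1 = y)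
    (hgeo : ∀ η : ℝ → Euc d, IsLipschitzPath η → η 0 = x → η 1 = y →
      fdtmLength m p β μ γ ≤ fdtmLength m p β μ η) :
    eucLength γ ≤ (64 * (5 : ℝ) ^ β * β) / (m * Real.log 2) *
      (⨆ t ∈ Icc (0 : ℝ) 1, dtm m p μ (γ t)) := by
  subst h0 h1
  obtain ⟨K, hK⟩ := id hlip
  have hm0 := hm.1
  have hβ0 : 0 < β := by linarith
  have hcont : Continuous fun t => dtm m p μ (γ t) :=
    (lipschitzWith_dtm hm hp).continuous.comp hK.continuous
  obtain ⟨C, hC⟩ := isCompact_Icc.bddAbove_image (hcont.continuousOn (s := Icc (0 : ℝ) 1))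
  have hC' : ∀ t ∈ Icc (0 : ℝ) 1, dtm m p μ (γ t) ≤ C := fun t ht => hC ⟨t, ht, rfl⟩
  have hC0 : 0 ≤ C := (dtm_nonneg hm hp _).trans (hC' 0 (by simp))
  set M := ⨆ t ∈ Icc (0 : ℝ) 1, dtm m p μ (γ t) with hM
  have hle : ∀ t ∈ Icc (0 : ℝ) 1, dtm m p μ (γ t) ≤ M := by
    intro t ht
    refine le_ciSup_of_le ⟨C, ?_⟩ t (ciSup_pos (f := fun _ => dtm m p μ (γ t)) ht).ge
    rintro _ ⟨s, rfl⟩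
    exact Real.iSup_le (hC' s) hC0
  have hM0 : 0 ≤ M := (dtm_nonneg hm hp _).trans (hle 0 (by simp))
  set q := (2 : ℝ) ^ (-(1 / β)) with hq
  have hq0 : 0 < q := by positivity
  have hq1 : q < 1 := Real.rpow_lt_one_of_one_lt_of_neg one_lt_two (by simpa using hβ0)
  set c := 32 * 5 ^ β / m with hc
  have hc0 : 0 < c := by positivity
  have hlen : lengthMeasure γ (Icc 0 1) = ENNReal.ofReal (eucLength γ) :=
    lengthMeasure_eq_ofReal_integral hK measurableSet_Icc Subset.rfl
  let L : ℕ → Set ℝ := fun k =>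
    {t | t ∈ Icc 0 1 ∧ M * q ^ k * q < dtm m p μ (γ t) ∧ dtm m p μ (γ t) ≤ M * q ^ k}
  have hcover : Icc (0 : ℝ) 1 ⊆ {t | dtm m p μ (γ t) = 0} ∪ ⋃ k, L k := by
    intro t ht
    rcases (dtm_nonneg (μ := μ) hm hp (γ t)).eq_or_lt with h | h
    · exact Or.inl h.symm
    · have hMpos : 0 < M := h.trans_le (hle t ht)
      obtain ⟨k, hk1, hk2⟩ := exists_nat_pow_near_of_lt_one (div_pos h hMpos)
        ((div_le_one hMpos).2 (hle t ht)) hq0 hq1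
      rw [lt_div_iff₀ hMpos, pow_succ] at hk1
      rw [div_le_iff₀ hMpos] at hk2
      exact Or.inr (mem_iUnion.2 ⟨k, ht, by linarith, by linarith⟩)
  have hlevel : ∀ k, lengthMeasure γ (L k) ≤ ENNReal.ofReal (c * M * q ^ k) := by
    intro k
    rcases hM0.eq_or_lt with h | h
    · have hempty : L k = ∅ := eq_empty_of_forall_notMem fun t ht => by
        have := ht.2.1.trans_le ht.2.2
        simp [← h] at this
      rw [hempty, measure_empty]
      exact zero_le
    · rw [mul_assoc]
      exact lengthMeasure_level_le hm hp hβ hlip hgeo (by positivity)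
  have hsum : ENNReal.ofReal (eucLength γ) ≤ ENNReal.ofReal (c * M * (1 - q)⁻¹) :=
    calc ENNReal.ofReal (eucLength γ)
        ≤ lengthMeasure γ ({t | dtm m p μ (γ t) = 0} ∪ ⋃ k, L k) := hlen ▸ measure_mono hcover
      _ ≤ 0 + ∑' k, lengthMeasure γ (L k) := (measure_union_le _ _).trans
          (add_le_add (lengthMeasure_dtm_eq_zero hm hp hK.continuous).le (measure_iUnion_le _))
      _ ≤ ∑' k, ENNReal.ofReal (c * M * q ^ k) := by
          rw [zero_add]
          exact ENNReal.tsum_le_tsum hlevel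
      _ = ENNReal.ofReal (c * M * (1 - q)⁻¹) := by
          rw [← ENNReal.ofReal_tsum_of_nonneg (fun k => by positivity)
            ((summable_geometric_of_lt_one hq0.le hq1).mul_left _), tsum_mul_left,
            tsum_geometric_of_lt_one hq0.le hq1]
  have hq1' : 0 ≤ (1 - q)⁻¹ := inv_nonneg.2 (by linarith)
  calc eucLength γ ≤ c * M * (1 - q)⁻¹ := (ENNReal.ofReal_le_ofReal_iff (by positivity)).1 hsum
    _ ≤ c * M * (2 * β / Real.log 2) := by
        have := inv_one_sub_two_rpow_le hβ
        gcongr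
    _ = (64 * (5 : ℝ) ^ β * β) / (m * Real.log 2) * M := by
        have : Real.log 2 ≠ 0 := (Real.log_pos one_lt_two).ne'
        rw [hc]
        field_simp
        ring

end
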